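/- For all n ≥ 1 and k ≥ 0, the number D_1(k,n) of overpartitions of n into parts congruent to 1 or 2 modulo 3 with exactly k non-overlined parts equals the number E_1(k,n) of overpartitions of n with exactly k non-overlined parts in which consecutive parts differ by at least 3 if the smaller part is overlined or both parts are divisible by 3, and by at least 6 if the smaller part is overlined and both parts are divisible by 3. (Lovejoy's overpartition analogue of Schur's theorem.) -/

import Mathlib

/-- An overpartition is encoded as a list of pairs `(part, overlined?)`: parts are positive,
values are non-increasing, and an overlined part must be the first occurrence of its value
(i.e. strictly smaller than the preceding part). -/
def IsOverpartition (l : List (ℕ × Bool)) : Prop :=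
  (∀ p ∈ l, 0 < p.1) ∧
  l.Chain' (fun p s => s.1 ≤ p.1 ∧ (s.2 = true → s.1 < p.1))

/-- The sum of the parts of an overpartition. -/
def opSum (l : List (ℕ × Bool)) : ℕ := (l.map Prod.fst).sum

/-- The number of non-overlined parts of an overpartition. -/
def opFree (l : List (ℕ × Bool)) : ℕ := (l.filter (fun p => p.2 = false)).length

/-- The sequences `f` with `f 0 = 1` whose generating function `F` satisfies
`F(x) - F(xQ) = p x F(x) + t x F(xQ) - r x ^ 2 F(x)`. -/
structure IsQDiffSeq {R : Type*} [CommRing R] (Q p t r : R) (f : ℕ → R) : Prop where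
  zero : f 0 = 1
  one : (1 - Q) * f 1 = p + t
  add_two : ∀ s, (1 - Q ^ (s + 2)) * f (s + 2) = (p + t * Q ^ (s + 1)) * f (s + 1) - r * f s

namespace IsQDiffSeq

variable {R : Type*} [CommRing R] {Q p t r a b d : R} {f g : ℕ → R}

theorem exists_seq (hQ : ∀ s, IsUnit (1 - Q ^ (s + 1))) (p t r : R) :
    ∃ f, IsQDiffSeq Q p t r f := by
  choose u hu using fun s => (hQ s).exists_right_inv
  let F : ℕ → R × R := Nat.rec (1, u 0 * (p + t))
    fun s x => (x.2, u (s + 1) * ((p + t * Q ^ (s + 1)) * x.2 - r * x.1))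
  have hF : ∀ s, F (s + 1) = ((F s).2, u (s + 1) * ((p + t * Q ^ (s + 1)) * (F s).2
    - r * (F s).1)) := fun _ => rfl
  refine ⟨fun s => (F s).1, rfl, ?_, fun s => ?_⟩
  · have := hu 0
    simp only [zero_add, pow_one] at this
    change (1 - Q) * (u 0 * (p + t)) = _
    linear_combination (p + t) * this
  · simp only [hF]
    linear_combination ((p + t * Q ^ (s + 1)) * (F s).2 - r * (F s).1) * hu (s + 1)

theorem unique (hQ : ∀ s, IsUnit (1 - Q ^ (s + 1))) (hf : IsQDiffSeq Q p t r f)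
    (hg : IsQDiffSeq Q p t r g) : f = g := by
  funext s
  induction s using Nat.twoStepInduction with
  | zero => rw [hf.zero, hg.zero]
  | one =>
    have h := hQ 0
    rw [zero_add, pow_one] at h
    exact h.mul_left_cancel (hf.one.trans hg.one.symm)
  | more s h₀ h₁ =>
    apply (hQ (s + 1)).mul_left_cancel
    rw [hf.add_two, hg.add_two, h₀, h₁]

theorem dvd (hQ : ∀ s, IsUnit (1 - Q ^ (s + 1))) {y : R} (hp : y ∣ p) (ht : y ∣ t)
    (hr : y ^ 2 ∣ r) (hf : IsQDiffSeq Q p t r f) (s : ℕ) : y ^ s ∣ f s := by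
  induction s using Nat.twoStepInduction with
  | zero => simp
  | one =>
    have h := hQ 0
    rw [zero_add, pow_one] at h
    rw [← h.dvd_mul_left, hf.one, pow_one]
    exact dvd_add hp ht
  | more s h₀ h₁ =>
    rw [← (hQ (s + 1)).dvd_mul_left, hf.add_two]
    refine dvd_sub ?_ ?_
    · rw [pow_succ' y (s + 1)]
      exact mul_dvd_mul (dvd_add hp (ht.mul_right _)) h₁
    · rw [pow_add, mul_comm]
      exact mul_dvd_mul hr h₀

/-- If `ψ` is the sequence for the parameters `(a + b, abQ, ab)`, then the generating function
`(1 + abx) ψ(x)` belongs to `(a + b, ab, ab)`. -/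
theorem mul_one_add (hf : IsQDiffSeq Q (a + b) (a * b * Q) (a * b) f)
    (h0 : g 0 = 1) (hs : ∀ s, g (s + 1) = f (s + 1) + a * b * f s) :
    IsQDiffSeq Q (a + b) (a * b) (a * b) g := by
  have hz := hf.zero
  have h1 := hf.one
  refine ⟨h0, ?_, fun s => ?_⟩
  · rw [hs, hz]
    linear_combination h1
  · have h2 := hf.add_two s
    rw [hs, hs]
    cases s with
    | zero =>
      rw [h0]
      simp only [zero_add] at *
      rw [hz] at *
      linear_combination h2 + a * b * h1
    | succ s =>
      rw [hs]
      linear_combination h2 + a * b * hf.add_two s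

/-- If `ψ` is the sequence for the parameters `(a + b, abQ, ab)`, then the generating function
`(1 - ax) ψ(x)` belongs to `(aQ + b, abQ, abQ)`. -/
theorem mul_one_sub (hf : IsQDiffSeq Q (a + b) (a * b * Q) (a * b) f)
    (h0 : g 0 = 1) (hs : ∀ s, g (s + 1) = f (s + 1) - a * f s) :
    IsQDiffSeq Q (a * Q + b) (a * Q * b) (a * Q * b) g := by
  have hz := hf.zero
  have h1 := hf.one
  refine ⟨h0, ?_, fun s => ?_⟩
  · rw [hs, hz]
    linear_combination h1
  · have h2 := hf.add_two s
    rw [hs, hs]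
    cases s with
    | zero =>
      rw [h0]
      simp only [zero_add] at *
      rw [hz] at *
      linear_combination h2 - a * Q * h1
    | succ s =>
      rw [hs]
      linear_combination h2 - a * Q * hf.add_two s

theorem contiguous (hQ : ∀ s, IsUnit (1 - Q ^ (s + 1)))
    (hf : IsQDiffSeq Q (a + b) (a * b) (a * b) f)
    (hg : IsQDiffSeq Q (a * Q + b) (a * Q * b) (a * Q * b) g) (s : ℕ) :
    (1 + a * Q ^ (s + 1)) * f (s + 1) = (1 + a) * g (s + 1) + a * f s := by
  obtain ⟨ψ, hψ⟩ := exists_seq hQ (a + b) (a * b * Q) (a * b)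
  have hf' := hf.unique hQ (hψ.mul_one_add
    (g := fun s => Nat.casesOn s 1 fun s => ψ (s + 1) + a * b * ψ s) rfl fun _ => rfl)
  have hg' := hg.unique hQ (hψ.mul_one_sub
    (g := fun s => Nat.casesOn s 1 fun s => ψ (s + 1) - a * ψ s) rfl fun _ => rfl)
  subst hf' hg'
  cases s with
  | zero =>
    have h1 := hψ.one
    simp only [zero_add, hψ.zero]
    change _ = _ + a * 1
    linear_combination -a * h1
  | succ s =>
    have h2 := hψ.add_two s
    simp only
    linear_combination -a * h2

/-- Shifting `a` to `aQ` in the sum of a sequence weighted by `∏_{i < s} (d + Q ^ i)`. -/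
theorem sum_shift (hQ : ∀ s, IsUnit (1 - Q ^ (s + 1)))
    (hf : IsQDiffSeq Q (a + b) (a * b) (a * b) f)
    (hg : IsQDiffSeq Q (a * Q + b) (a * Q * b) (a * Q * b) g) (S : ℕ) :
    (1 - d * a) * ∑ s ∈ Finset.range (S + 1), (∏ i ∈ Finset.range s, (d + Q ^ i)) * f s
      - (1 + a) * ∑ s ∈ Finset.range (S + 1), (∏ i ∈ Finset.range s, (d + Q ^ i)) * g s
      = -a * (∏ i ∈ Finset.range (S + 1), (d + Q ^ i)) * f S := by
  induction S with
  | zero =>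
    simp [hf.zero, hg.zero]
    ring
  | succ S ih =>
    rw [Finset.sum_range_succ, Finset.sum_range_succ _ (S + 1), Finset.prod_range_succ _ (S + 1)]
    have h := contiguous hQ hf hg S
    linear_combination ih + (∏ i ∈ Finset.range (S + 1), (d + Q ^ i)) * h

end IsQDiffSeq

theorem schur_sum_congr {R : Type*} [CommRing R] {q d : R}
    (hQ : ∀ s, IsUnit (1 - (q ^ 3) ^ (s + 1))) (hd : ∀ m, IsUnit (1 - d * q ^ (m + 1)))
    {V : ℕ → R} (hV : ∀ m, ¬ 3 ∣ m + 1 → (1 - d * q ^ (m + 1)) * V m = (1 + q ^ (m + 1)) * V (m + 1))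
    (hV' : ∀ m, 3 ∣ m + 1 → V m = V (m + 1)) (hV1 : ∀ m, q ^ m ∣ V m - 1)
    {N i : ℕ} (hi : i ≤ N) {f : ℕ → R}
    (hf : IsQDiffSeq (q ^ 3) (q ^ (3 * i + 1) + q ^ (3 * i + 2))
      (q ^ (3 * i + 1) * q ^ (3 * i + 2)) (q ^ (3 * i + 1) * q ^ (3 * i + 2)) f) :
    q ^ N ∣ ∑ s ∈ Finset.range (N + 1), (∏ j ∈ Finset.range s, (d + (q ^ 3) ^ j)) * f s
      - V (3 * i) := by
  induction hi using Nat.decreasingInduction generalizing f with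
  | self =>
    have h := (pow_dvd_pow q (show N ≤ 3 * N by omega)).trans (hV1 (3 * N))
    rw [Finset.sum_range_succ', ← sub_sub_sub_cancel_right _ _ 1]
    refine dvd_sub ?_ h
    rw [hf.zero, Finset.prod_range_zero, one_mul, add_sub_cancel_right]
    refine Finset.dvd_sum fun s _ => Dvd.dvd.mul_left ?_ _
    have h : (q ^ N) ^ (s + 1) ∣ f (s + 1) := by
      refine hf.dvd hQ (dvd_add ?_ ?_) (Dvd.dvd.mul_right ?_ _) ?_ _
      · exact pow_dvd_pow _ (by omega)
      · exact pow_dvd_pow _ (by omega)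
      · exact pow_dvd_pow _ (by omega)
      · rw [← pow_mul, ← pow_add]
        exact pow_dvd_pow _ (by omega)
    exact (dvd_pow_self _ (by omega)).trans h
  | of_succ i hi ih =>
    set a := q ^ (3 * i + 1)
    set b := q ^ (3 * i + 2)
    have ha : q ^ (3 * (i + 1) + 1) = a * q ^ 3 := by simp only [a, ← pow_add]; congr 1
    have hb : q ^ (3 * (i + 1) + 2) = b * q ^ 3 := by simp only [b, ← pow_add]; congr 1
    rw [ha, hb] at ih
    obtain ⟨g, hg⟩ := IsQDiffSeq.exists_seq hQ (a * q ^ 3 + b) (a * q ^ 3 * b) (a * q ^ 3 * b)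
    obtain ⟨h, hh⟩ := IsQDiffSeq.exists_seq hQ (a * q ^ 3 + b * q ^ 3)
      (a * q ^ 3 * (b * q ^ 3)) (a * q ^ 3 * (b * q ^ 3))
    have h₁ := hf.sum_shift (d := d) hQ hg N
    have h₂ := IsQDiffSeq.sum_shift (a := b) (b := a * q ^ 3) (d := d) hQ (f := g) (g := h)
      (by convert hg using 1 <;> ring) (by convert hh using 1 <;> ring) N
    have h₃ := ih hh
    have hqa : q ∣ a := dvd_pow_self _ (by omega)
    have hqb : q ∣ b := dvd_pow_self _ (by omega)
    have hf' : q ^ N ∣ f N :=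
      hf.dvd hQ (dvd_add hqa hqb) (hqa.mul_right _) (by rw [sq]; exact mul_dvd_mul hqa hqb) N
    have hg' : q ^ N ∣ g N := by
      refine hg.dvd hQ (dvd_add (hqa.mul_right _) hqb) (hqb.mul_left _) ?_ N
      rw [sq]
      exact mul_dvd_mul (hqa.mul_right _) hqb
    have hVa : (1 - d * a) * V (3 * i) = (1 + a) * V (3 * i + 1) := hV (3 * i) (by omega)
    have hVb : (1 - d * b) * V (3 * i + 1) = (1 + b) * V (3 * (i + 1)) :=
      (hV (3 * i + 1) (by omega)).trans (congrArg _ (hV' (3 * i + 2) (by omega)))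
    rw [← (hd (3 * i)).dvd_mul_left, ← (hd (3 * i + 1)).dvd_mul_left]
    change _ ∣ (1 - d * b) * ((1 - d * a) * _)
    obtain ⟨x, hx⟩ := hf'
    obtain ⟨y, hy⟩ := hg'
    obtain ⟨z, hz⟩ := h₃
    rw [hx] at h₁
    rw [hy] at h₂
    refine ⟨(1 - d * b) * (-a * (∏ i ∈ Finset.range (N + 1), (d + (q ^ 3) ^ i)) * x)
      + (1 + a) * (-b * (∏ i ∈ Finset.range (N + 1), (d + (q ^ 3) ^ i)) * y)
      + (1 + a) * (1 + b) * z, ?_⟩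
    linear_combination (1 - d * b) * h₁ + (1 + a) * h₂ + (1 + a) * (1 + b) * hz
      - (1 - d * b) * hVa - (1 + a) * hVb

open PowerSeries in
/-- The generating function of a set of overpartitions: the outer variable records the sum of the
parts and the inner one the number of non-overlined parts. -/
noncomputable def overGF (A : Set (List (ℕ × Bool))) : PowerSeries (PowerSeries ℤ) :=
  mk fun n => mk fun k => ((A ∩ {l | opFree l = k ∧ opSum l = n}).ncard : ℤ)

@[simp] theorem opSum_nil : opSum [] = 0 := rfl

@[simp] theorem opFree_nil : opFree [] = 0 := rfl

@[simp] theorem opSum_cons (p : ℕ × Bool) (l : List (ℕ × Bool)) :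
    opSum (p :: l) = p.1 + opSum l := by
  simp [opSum]

@[simp] theorem opFree_cons_true (v : ℕ) (l : List (ℕ × Bool)) :
    opFree ((v, true) :: l) = opFree l := by
  simp [opFree]

@[simp] theorem opFree_cons_false (v : ℕ) (l : List (ℕ × Bool)) :
    opFree ((v, false) :: l) = opFree l + 1 := by
  simp [opFree]

theorem finite_setOf_opSum_eq (n : ℕ) :
    {l : List (ℕ × Bool) | (∀ p ∈ l, 0 < p.1) ∧ opSum l = n}.Finite := by
  induction n using Nat.strong_induction_on with
  | _ n ih =>
    have h : (⋃ p ∈ (Set.Icc 1 n ×ˢ Set.univ : Set (ℕ × Bool)), List.cons p ''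
        {l : List (ℕ × Bool) | (∀ p ∈ l, 0 < p.1) ∧ opSum l = n - p.1}).Finite := by
      refine Set.Finite.biUnion ((Set.finite_Icc 1 n).prod Set.finite_univ) fun p hp => ?_
      simp only [Set.mem_prod, Set.mem_Icc, Set.mem_univ, and_true] at hp
      exact (ih _ (by omega)).image _
    refine (h.union (Set.finite_singleton [])).subset ?_
    rintro (_ | ⟨p, l⟩) ⟨hl, hn⟩
    · exact Or.inr rfl
    · left
      rw [opSum_cons] at hn
      have hp := hl p List.mem_cons_self
      simp only [Set.mem_iUnion]
      exact ⟨p, ⟨⟨hp, by omega⟩, trivial⟩, l,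
        ⟨fun x hx => hl x (List.mem_cons_of_mem _ hx), by omega⟩, rfl⟩

theorem finite_inter_of_pos {A : Set (List (ℕ × Bool))} (hA : ∀ l ∈ A, ∀ p ∈ l, 0 < p.1)
    (n k : ℕ) : (A ∩ {l | opFree l = k ∧ opSum l = n}).Finite :=
  (finite_setOf_opSum_eq n).subset fun l hl => ⟨hA l hl.1, hl.2.2⟩

open PowerSeries in
theorem coeff_coeff_overGF (A : Set (List (ℕ × Bool))) (n k : ℕ) :
    coeff k (coeff n (overGF A)) = ((A ∩ {l | opFree l = k ∧ opSum l = n}).ncard : ℤ) := by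
  simp [overGF]

theorem coeff_coeff_overGF_eq_zero {A : Set (List (ℕ × Bool))} {n k : ℕ}
    (h : ∀ l ∈ A, opSum l = n → opFree l ≠ k) :
    PowerSeries.coeff k (PowerSeries.coeff n (overGF A)) = 0 := by
  rw [coeff_coeff_overGF, Nat.cast_eq_zero, ← Set.ncard_empty (List (ℕ × Bool))]
  congr 1
  exact Set.eq_empty_iff_forall_notMem.2 fun l hl => h l hl.1 hl.2.2 hl.2.1

theorem overGF_union {A B : Set (List (ℕ × Bool))} (hA : ∀ l ∈ A, ∀ p ∈ l, 0 < p.1)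
    (hB : ∀ l ∈ B, ∀ p ∈ l, 0 < p.1) (h : Disjoint A B) :
    overGF (A ∪ B) = overGF A + overGF B := by
  ext n k
  rw [map_add, map_add, coeff_coeff_overGF, coeff_coeff_overGF, coeff_coeff_overGF,
    Set.union_inter_distrib_right, Set.ncard_union_eq (h.mono Set.inter_subset_left
    Set.inter_subset_left) (finite_inter_of_pos hA n k) (finite_inter_of_pos hB n k)]
  push_cast
  rfl

open PowerSeries in
theorem overGF_image {A : Set (List (ℕ × Bool))} {f : List (ℕ × Bool) → List (ℕ × Bool)}
    (hf : f.Injective) (i j : ℕ) (hs : ∀ l ∈ A, opSum (f l) = opSum l + i)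
    (hr : ∀ l ∈ A, opFree (f l) = opFree l + j) :
    overGF (f '' A) = C (X ^ j) * (X ^ i * overGF A) := by
  ext n k
  rw [coeff_C_mul, coeff_X_pow_mul', coeff_X_pow_mul']
  by_cases hi : i ≤ n
  · by_cases hj : j ≤ k
    · rw [if_pos hi, if_pos hj, coeff_coeff_overGF, coeff_coeff_overGF,
        ← Set.ncard_image_of_injective (A ∩ {l | opFree l = k - j ∧ opSum l = n - i}) hf]
      rw [Nat.cast_inj]
      congr 1
      ext l
      simp only [Set.mem_inter_iff, Set.mem_image, Set.mem_ofPred_eq]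
      constructor
      · rintro ⟨⟨l, hl, rfl⟩, h₁, h₂⟩
        rw [hs l hl] at h₂
        rw [hr l hl] at h₁
        exact ⟨l, ⟨hl, by omega, by omega⟩, rfl⟩
      · rintro ⟨l, ⟨hl, h₁, h₂⟩, rfl⟩
        refine ⟨⟨l, hl, rfl⟩, ?_, ?_⟩
        · rw [hr l hl]; omega
        · rw [hs l hl]; omega
    · rw [if_pos hi, if_neg hj]
      refine coeff_coeff_overGF_eq_zero ?_
      rintro _ ⟨l, hl, rfl⟩ -
      rw [hr l hl]
      omega
  · rw [if_neg hi, map_zero, ite_self]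
    refine coeff_coeff_overGF_eq_zero ?_
    rintro _ ⟨l, hl, rfl⟩ h
    rw [hs l hl] at h
    omega

open PowerSeries in
theorem X_pow_dvd_overGF {A : Set (List (ℕ × Bool))} {m : ℕ} (hA : ∀ l ∈ A, m ≤ opSum l) :
    X ^ m ∣ overGF A := by
  rw [X_pow_dvd_iff]
  intro n hn
  ext k
  refine coeff_coeff_overGF_eq_zero fun l hl h => ?_
  have := hA l hl
  omega

open PowerSeries in
theorem overGF_nil : overGF {[]} = 1 := by
  ext n k
  rw [coeff_one]
  by_cases hn : n = 0
  · by_cases hk : k = 0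
    · subst hn hk
      have : ({[]} ∩ {l | opFree l = 0 ∧ opSum l = 0} : Set (List (ℕ × Bool))) = {[]} :=
        Set.inter_eq_left.2 (by simp)
      rw [coeff_coeff_overGF, this]
      simp
    · rw [if_pos hn, coeff_one, if_neg hk]
      refine coeff_coeff_overGF_eq_zero ?_
      rintro _ rfl - h
      exact hk h.symm
  · rw [if_neg hn, map_zero]
    refine coeff_coeff_overGF_eq_zero ?_
    rintro _ rfl h
    exact absurd h.symm hn

open PowerSeries in
theorem overGF_cons_true (v : ℕ) (A : Set (List (ℕ × Bool))) :
    overGF (List.cons (v, true) '' A) = X ^ v * overGF A := by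
  rw [overGF_image List.cons_injective v 0] <;> simp [add_comm]

open PowerSeries in
theorem overGF_cons_false (v : ℕ) (A : Set (List (ℕ × Bool))) :
    overGF (List.cons (v, false) '' A) = C X * (X ^ v * overGF A) := by
  rw [overGF_image List.cons_injective v 1] <;> simp [add_comm]

/-- Splitting a set of overpartitions, listed by increasing parts, according to whether the
smallest part is an overlined `v`, a non-overlined `v`, or something else. -/
theorem overGF_split {A B T F : Set (List (ℕ × Bool))} {v : ℕ}
    (hA : ∀ l ∈ A, ∀ p ∈ l, 0 < p.1)
    (hB : ∀ l, l ∈ B ↔ l ∈ A ∧ ∀ p ∈ l.head?, p.1 ≠ v)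
    (hT : ∀ l, l ∈ T ↔ (v, true) :: l ∈ A) (hF : ∀ l, l ∈ F ↔ (v, false) :: l ∈ A) :
    overGF A = PowerSeries.X ^ v * overGF T
      + PowerSeries.C PowerSeries.X * (PowerSeries.X ^ v * overGF F) + overGF B := by
  have h : A = List.cons (v, true) '' T ∪ List.cons (v, false) '' F ∪ B := by
    ext l
    simp only [Set.mem_union, Set.mem_image, hB, hT, hF]
    constructor
    · intro hl
      rcases l with _ | ⟨⟨w, o⟩, l⟩
      · exact Or.inr ⟨hl, by simp⟩
      · by_cases hw : w = v
        · subst hw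
          left
          cases o
          · exact Or.inr ⟨l, hl, rfl⟩
          · exact Or.inl ⟨l, hl, rfl⟩
        · exact Or.inr ⟨hl, by simpa using hw⟩
    · rintro ((⟨l, hl, rfl⟩ | ⟨l, hl, rfl⟩) | ⟨hl, -⟩) <;> exact hl
  have hAT : List.cons (v, true) '' T ⊆ A := by rw [h]; intro l hl; exact Or.inl (Or.inl hl)
  have hAF : List.cons (v, false) '' F ⊆ A := by rw [h]; intro l hl; exact Or.inl (Or.inr hl)
  have hAB : B ⊆ A := fun l hl => ((hB l).1 hl).1
  conv_lhs => rw [h]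
  rw [overGF_union, overGF_union, overGF_cons_true, overGF_cons_false]
  · exact fun l hl => hA l (hAT hl)
  · exact fun l hl => hA l (hAF hl)
  · rw [Set.disjoint_left]
    rintro _ ⟨l, -, rfl⟩ ⟨l', -, h⟩
    simp at h
  · exact fun l hl => hA l (Set.union_subset hAT hAF hl)
  · exact fun l hl => hA l (hAB hl)
  · rw [Set.disjoint_left]
    rintro _ (⟨l, -, rfl⟩ | ⟨l, -, rfl⟩) hl <;> simpa using ((hB _).1 hl).2

/-- The relation between a part `s` of an overpartition and a part `p` preceding it. -/
def OverRel (s p : ℕ × Bool) : Prop := s.1 ≤ p.1 ∧ (s.2 = true → s.1 < p.1)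

instance : IsTrans (ℕ × Bool) OverRel where
  trans := by
    rintro ⟨a, o⟩ ⟨b, o'⟩ ⟨c, o''⟩ ⟨h₁, h₂⟩ ⟨h₃, h₄⟩
    exact ⟨h₁.trans h₃, fun h => (h₂ h).trans_le h₃⟩

/-- The relation between a part `s` of an overpartition satisfying the difference conditions and
a part `p` preceding it. -/
def SchurRel (s p : ℕ × Bool) : Prop :=
  OverRel s p ∧ ((s.2 = true ∨ (3 ∣ p.1 ∧ 3 ∣ s.1)) → s.1 + 3 ≤ p.1) ∧
    ((s.2 = true ∧ 3 ∣ p.1 ∧ 3 ∣ s.1) → s.1 + 6 ≤ p.1)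

instance : IsTrans (ℕ × Bool) SchurRel where
  trans := by
    rintro ⟨a, o⟩ ⟨b, o'⟩ ⟨c, o''⟩ ⟨⟨h₁, h₂⟩, h₃, h₄⟩ ⟨⟨h₅, h₆⟩, h₇, h₈⟩
    refine ⟨_root_.trans (r := OverRel) ⟨h₁, h₂⟩ ⟨h₅, h₆⟩, ?_, ?_⟩
    · dsimp only at *
      rintro (h | ⟨hc, ha⟩)
      · have := h₃ (Or.inl h)
        omega
      · by_cases hb : 3 ∣ b
        · have := h₃ (Or.inr ⟨hb, ha⟩)
          omega
        · omega
    · dsimp only at *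
      rintro ⟨h, hc, ha⟩
      have := h₃ (Or.inl h)
      by_cases hb : 3 ∣ b
      · have := h₄ ⟨h, hb, ha⟩
        omega
      · omega

/-- Overpartitions, listed by increasing parts, into parts not divisible by 3 exceeding `m`. -/
def nonmultiples (m : ℕ) : Set (List (ℕ × Bool)) :=
  {l | l.Pairwise OverRel ∧ ∀ p ∈ l, m < p.1 ∧ ¬ 3 ∣ p.1}

/-- Overpartitions with `s` parts, listed by increasing parts, satisfying the difference conditions
with all parts exceeding `m`. -/
def schurLists (s m : ℕ) : Set (List (ℕ × Bool)) :=
  {l | l.length = s ∧ l.Pairwise SchurRel ∧ ∀ p ∈ l, m < p.1}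

theorem pos_of_mem_nonmultiples {m : ℕ} : ∀ l ∈ nonmultiples m, ∀ p ∈ l, 0 < p.1 :=
  fun _ hl p hp => (Nat.zero_le m).trans_lt (hl.2 p hp).1

theorem pos_of_mem_schurLists {s m : ℕ} : ∀ l ∈ schurLists s m, ∀ p ∈ l, 0 < p.1 :=
  fun _ hl p hp => (Nat.zero_le m).trans_lt (hl.2.2 p hp)

open PowerSeries in
theorem overGF_nonmultiples {m : ℕ} (hm : ¬ 3 ∣ m + 1) :
    (1 - C X * X ^ (m + 1)) * overGF (nonmultiples m)
      = (1 + X ^ (m + 1)) * overGF (nonmultiples (m + 1)) := by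
  have h := overGF_split (A := nonmultiples m) (B := nonmultiples (m + 1))
    (T := nonmultiples (m + 1)) (F := nonmultiples m) (v := m + 1) pos_of_mem_nonmultiples
    (fun l => ?_) (fun l => ?_) (fun l => ?_)
  · linear_combination h
  · simp only [nonmultiples, Set.mem_ofPred_eq]
    rcases l with _ | ⟨p, l⟩
    · simp
    · simp only [List.pairwise_cons, List.mem_cons, forall_eq_or_imp, List.head?_cons,
        Option.mem_some_iff, forall_eq', OverRel]
      constructor
      · rintro ⟨⟨h₁, h₂⟩, h₃, h₄⟩
        exact ⟨⟨⟨h₁, h₂⟩, ⟨by omega, h₃.2⟩, fun x hx => ⟨by have := h₄ x hx; omega, (h₄ x hx).2⟩⟩,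
          by omega⟩
      · rintro ⟨⟨⟨h₁, h₂⟩, h₃, h₄⟩, h₅⟩
        exact ⟨⟨h₁, h₂⟩, ⟨by omega, h₃.2⟩, fun x hx => ⟨by have := h₁ x hx; omega, (h₄ x hx).2⟩⟩
  · simp only [nonmultiples, Set.mem_ofPred_eq, List.pairwise_cons, List.mem_cons,
      forall_eq_or_imp, OverRel]
    constructor
    · rintro ⟨h₁, h₂⟩
      exact ⟨⟨fun x hx => by have := h₂ x hx; omega, h₁⟩, ⟨by omega, hm⟩,
        fun x hx => ⟨by have := h₂ x hx; omega, (h₂ x hx).2⟩⟩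
    · rintro ⟨⟨h₁, h₂⟩, -, h₃⟩
      exact ⟨h₂, fun x hx => ⟨(h₁ x hx).2 trivial, (h₃ x hx).2⟩⟩
  · simp only [nonmultiples, Set.mem_ofPred_eq, List.pairwise_cons, List.mem_cons,
      forall_eq_or_imp, OverRel]
    constructor
    · rintro ⟨h₁, h₂⟩
      exact ⟨⟨fun x hx => by have := h₂ x hx; simp; omega, h₁⟩, ⟨by omega, hm⟩, h₂⟩
    · rintro ⟨⟨h₁, h₂⟩, -, h₃⟩
      exact ⟨h₂, h₃⟩

theorem nonmultiples_succ {m : ℕ} (hm : 3 ∣ m + 1) : nonmultiples m = nonmultiples (m + 1) := by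
  ext l
  refine and_congr_right fun _ => forall₂_congr fun p _ => ?_
  omega

open PowerSeries in
theorem X_pow_dvd_overGF_nonmultiples_sub_one (m : ℕ) :
    X ^ m ∣ overGF (nonmultiples m) - 1 := by
  have h : nonmultiples m = nonmultiples m \ {[]} ∪ {[]} := by
    rw [Set.sdiff_union_of_subset]
    simp [nonmultiples]
  rw [h, overGF_union (fun l hl => pos_of_mem_nonmultiples l hl.1) (by simp)
    Set.disjoint_sdiff_left, overGF_nil, add_sub_cancel_right]
  refine X_pow_dvd_overGF ?_
  rintro (_ | ⟨p, l⟩) ⟨hl, h₀⟩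
  · exact absurd rfl h₀
  · have := (hl.2 p List.mem_cons_self).1
    rw [opSum_cons]
    omega

open PowerSeries in
theorem overGF_schurLists_add_three (s m : ℕ) :
    overGF (schurLists s (m + 3)) = (X ^ 3) ^ s * overGF (schurLists s m) := by
  have hinj : Function.Injective fun p : ℕ × Bool => (p.1 + 3, p.2) := by
    rintro ⟨a, o⟩ ⟨b, o'⟩ h
    simpa using h
  have hrel : ∀ x y : ℕ × Bool, SchurRel (x.1 + 3, x.2) (y.1 + 3, y.2) ↔ SchurRel x y := by
    rintro ⟨a, o⟩ ⟨b, o'⟩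
    simp only [SchurRel, OverRel, Nat.dvd_add_self_right, add_le_add_iff_right,
      add_lt_add_iff_right]
    rw [show a + 3 + 6 ≤ b + 3 ↔ a + 6 ≤ b by omega]
  have h : schurLists s (m + 3) =
      List.map (fun p : ℕ × Bool => (p.1 + 3, p.2)) '' schurLists s m := by
    ext l
    constructor
    · rintro ⟨h₁, h₂, h₃⟩
      have hl : (l.map fun p : ℕ × Bool => (p.1 - 3, p.2)).map
          (fun p : ℕ × Bool => (p.1 + 3, p.2)) = l := by
        rw [List.map_map]
        refine (List.map_congr_left fun p hp => ?_).trans (List.map_id l)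
        have := h₃ p hp
        ext <;> simp
        omega
      refine ⟨l.map fun p : ℕ × Bool => (p.1 - 3, p.2), ⟨by simpa using h₁, ?_, ?_⟩, hl⟩
      · rw [← hl, List.pairwise_map] at h₂
        simpa only [hrel] using h₂
      · simp only [List.mem_map]
        rintro _ ⟨p, hp, rfl⟩
        have := h₃ p hp
        dsimp only
        omega
    · rintro ⟨l, ⟨h₁, h₂, h₃⟩, rfl⟩
      refine ⟨by simpa using h₁, ?_, ?_⟩
      · rw [List.pairwise_map]
        simpa only [hrel] using h₂
      · simp only [List.mem_map]
        rintro _ ⟨p, hp, rfl⟩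
        have := h₃ p hp
        dsimp only
        omega
  rw [h, overGF_image (List.map_injective_iff.2 hinj) (3 * s) 0, pow_zero, map_one, one_mul,
    pow_mul]
  · rintro l ⟨rfl, -⟩
    clear h
    induction l with
    | nil => simp
    | cons p l ih =>
      rw [List.map_cons, opSum_cons, ih, opSum_cons, List.length_cons]
      ring
  · rintro l -
    induction l with
    | nil => rfl
    | cons p l ih =>
      rcases p with ⟨v, _ | _⟩ <;> simpa using ih

open PowerSeries in
theorem overGF_schurLists_succ (s : ℕ) {m t : ℕ}
    (h : m % 3 ≤ 1 ∧ t = m ∨ m % 3 = 2 ∧ t = m + 1) :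
    overGF (schurLists (s + 1) m) = X ^ (m + 1) * (C X + (X ^ 3) ^ s) * overGF (schurLists s t)
      + overGF (schurLists (s + 1) (m + 1)) := by
  have h := overGF_split (A := schurLists (s + 1) m) (B := schurLists (s + 1) (m + 1))
    (T := schurLists s (t + 3)) (F := schurLists s t) (v := m + 1) pos_of_mem_schurLists
    (fun l => ?_) (fun l => ?_) (fun l => ?_)
  · rw [overGF_schurLists_add_three] at h
    linear_combination h
  · simp only [schurLists, Set.mem_ofPred_eq]
    rcases l with _ | ⟨p, l⟩
    · simp
    · simp only [List.pairwise_cons, List.mem_cons, forall_eq_or_imp, List.head?_cons,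
        Option.mem_some_iff, forall_eq']
      constructor
      · rintro ⟨h₀, h₁, h₃, h₄⟩
        exact ⟨⟨h₀, h₁, by omega, fun x hx => by have := h₄ x hx; omega⟩, by omega⟩
      · rintro ⟨⟨h₀, h₁, h₃, h₄⟩, h₅⟩
        exact ⟨h₀, h₁, by omega, fun x hx => by have := (h₁.1 x hx).1.1; omega⟩
  all_goals
    simp only [schurLists, Set.mem_ofPred_eq, List.pairwise_cons, List.mem_cons,
      forall_eq_or_imp, List.length_cons, add_left_inj, SchurRel, OverRel, true_or, true_and,
      Bool.false_eq_true, false_or, false_and, forall_const, false_imp_iff, and_true]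
    refine and_congr_right fun _ => ?_
    constructor
    · rintro ⟨h₁, h₂⟩
      exact ⟨⟨fun x hx => by have := h₂ x hx; omega, h₁⟩, by omega,
        fun x hx => by have := h₂ x hx; omega⟩
    · rintro ⟨⟨h₁, h₂⟩, -, h₃⟩
      exact ⟨h₂, fun x hx => by have := h₁ x hx; have := h₃ x hx; omega⟩

theorem schurLists_zero (m : ℕ) : schurLists 0 m = {[]} := by
  ext l
  simp only [schurLists, Set.mem_ofPred_eq, List.length_eq_zero_iff, Set.mem_singleton_iff]
  constructor
  · exact fun h => h.1
  · rintro rfl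
    simp

open PowerSeries in
theorem overGF_schurLists_zero_succ (s : ℕ) :
    (1 - (X ^ 3) ^ (s + 1)) * overGF (schurLists (s + 1) 0) =
      (C X + (X ^ 3) ^ s) * (X * overGF (schurLists s 0) + X ^ 2 * overGF (schurLists s 1)
        + X ^ 3 * (X ^ 3) ^ s * overGF (schurLists s 0)) := by
  have h₀ := overGF_schurLists_succ s (m := 0) (t := 0) (by simp)
  have h₁ := overGF_schurLists_succ s (m := 1) (t := 1) (by simp)
  have h₂ := overGF_schurLists_succ s (m := 2) (t := 3) (by simp)
  have h₃ := overGF_schurLists_add_three s 0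
  have h₄ := overGF_schurLists_add_three (s + 1) 0
  simp only [zero_add, Nat.reduceAdd] at h₀ h₁ h₂ h₃ h₄
  rw [h₃, h₄] at h₂
  linear_combination h₀ + h₁ + h₂

open PowerSeries in
theorem overGF_schurLists_zero {f : ℕ → PowerSeries (PowerSeries ℤ)}
    (hQ : ∀ s, IsUnit (1 - ((X : PowerSeries (PowerSeries ℤ)) ^ 3) ^ (s + 1)))
    (hf : IsQDiffSeq (X ^ 3) (X + X ^ 2) (X ^ 3) (X ^ 3) f) (s : ℕ) :
    overGF (schurLists s 0) = (∏ j ∈ Finset.range s, (C X + (X ^ 3) ^ j)) * f s := by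
  induction s using Nat.twoStepInduction with
  | zero => rw [schurLists_zero, overGF_nil, hf.zero]; simp
  | one =>
    apply (hQ 0).mul_left_cancel
    rw [overGF_schurLists_zero_succ, schurLists_zero, schurLists_zero, overGF_nil,
      Finset.prod_range_one]
    have h := hf.one
    linear_combination -(C X + 1) * h
  | more s h₀ h₁ =>
    apply (hQ (s + 1)).mul_left_cancel
    have h₂ := overGF_schurLists_succ s (m := 0) (t := 0) (by simp)
    simp only [zero_add] at h₂
    rw [overGF_schurLists_zero_succ, ← sub_eq_iff_eq_add'.2 h₂, h₀, h₁]
    simp only [Finset.prod_range_succ]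
    have h := hf.add_two s
    linear_combination -(∏ j ∈ Finset.range s, (C X + (X ^ 3) ^ j)) * (C X + (X ^ 3) ^ s)
      * (C X + (X ^ 3) ^ (s + 1)) * h

theorem overGF_setOf_length_le (N : ℕ) :
    overGF {l | l.length ≤ N ∧ l ∈ schurLists l.length 0} =
      ∑ s ∈ Finset.range (N + 1), overGF (schurLists s 0) := by
  induction N with
  | zero =>
    rw [Finset.sum_range_one]
    congr 1
    ext l
    constructor
    · rintro ⟨h₁, h₂⟩
      rwa [Nat.le_zero.1 h₁] at h₂
    · intro h
      have : l.length = 0 := h.1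
      exact ⟨this.le, by rwa [this]⟩
  | succ N ih =>
    rw [Finset.sum_range_succ, ← ih, ← overGF_union]
    · congr 1
      ext l
      constructor
      · rintro ⟨h₁, h₂⟩
        rcases h₁.lt_or_eq with h | h
        · exact Or.inl ⟨Nat.lt_succ_iff.1 h, h₂⟩
        · exact Or.inr (h ▸ h₂)
      · rintro (⟨h₁, h₂⟩ | h)
        · exact ⟨h₁.trans N.le_succ, h₂⟩
        · exact ⟨h.1.le, by rwa [h.1]⟩
    · exact fun l hl => pos_of_mem_schurLists l hl.2
    · exact pos_of_mem_schurLists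
    · rw [Set.disjoint_left]
      rintro l ⟨h, -⟩ hl
      have : l.length = N + 1 := hl.1
      omega

open PowerSeries in
theorem X_pow_dvd_overGF_sub (N : ℕ) :
    X ^ N ∣ overGF {l | l.length ≤ N ∧ l ∈ schurLists l.length 0} - overGF (nonmultiples 0) := by
  have hX : ∀ (c : PowerSeries (PowerSeries ℤ)) (n : ℕ), IsUnit (1 - c * X ^ (n + 1)) := by
    intro c n
    rw [isUnit_iff_constantCoeff]
    simp
  have hQ : ∀ s, IsUnit (1 - ((X : PowerSeries (PowerSeries ℤ)) ^ 3) ^ (s + 1)) := by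
    intro s
    have := hX 1 (3 * s + 2)
    rwa [one_mul, show 3 * s + 2 + 1 = 3 * (s + 1) by ring, pow_mul] at this
  obtain ⟨f, hf⟩ := IsQDiffSeq.exists_seq hQ (X + X ^ 2) (X ^ 3) (X ^ 3)
  rw [overGF_setOf_length_le, Finset.sum_congr rfl fun s _ => overGF_schurLists_zero hQ hf s]
  refine schur_sum_congr (V := fun m => overGF (nonmultiples m)) hQ (hX (C X))
    (fun m => overGF_nonmultiples) (fun m hm => congrArg _ (nonmultiples_succ hm))
    X_pow_dvd_overGF_nonmultiples_sub_one (Nat.zero_le N) ?_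
  convert hf using 1 <;> ring

theorem length_le_opSum {l : List (ℕ × Bool)} (h : ∀ p ∈ l, 0 < p.1) : l.length ≤ opSum l := by
  induction l with
  | nil => simp
  | cons p l ih =>
    have h₁ := h p List.mem_cons_self
    have h₂ := ih fun x hx => h x (List.mem_cons_of_mem _ hx)
    rw [opSum_cons, List.length_cons]
    omega

theorem opSum_reverse (l : List (ℕ × Bool)) : opSum l.reverse = opSum l := by
  simp [opSum]

theorem opFree_reverse (l : List (ℕ × Bool)) : opFree l.reverse = opFree l := by
  simp [opFree]

theorem ncard_reverse {A B : Set (List (ℕ × Bool))} (h : ∀ l, l.reverse ∈ B ↔ l ∈ A) :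
    A.ncard = B.ncard := by
  rw [← Set.ncard_image_of_injective _ List.reverse_injective]
  congr 1
  ext l
  constructor
  · rintro ⟨l, hl, rfl⟩
    exact (h l).2 hl
  · intro hl
    exact ⟨l.reverse, (h _).1 (by rwa [List.reverse_reverse]), List.reverse_reverse l⟩

/-- Lovejoy's overpartition analogue of Schur's theorem: for `n ≥ 1` and `k ≥ 0`, the number
of overpartitions of `n` into parts `≡ 1, 2 (mod 3)` with `k` non-overlined parts equals the
number of overpartitions of `n` with `k` non-overlined parts where consecutive parts differ by
at least `3` if the smaller is overlined or both are divisible by `3`, and by at least `6` if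
the smaller is overlined and both are divisible by `3`. -/
theorem lovejoy_schur_overpartitions (n k : ℕ) (hn : 1 ≤ n) :
    Nat.card {l : List (ℕ × Bool) // IsOverpartition l ∧
        (∀ p ∈ l, p.1 % 3 = 1 ∨ p.1 % 3 = 2) ∧ opFree l = k ∧ opSum l = n}
      = Nat.card {l : List (ℕ × Bool) // IsOverpartition l ∧
          l.Chain' (fun p s =>
            ((s.2 = true ∨ (3 ∣ p.1 ∧ 3 ∣ s.1)) → s.1 + 3 ≤ p.1) ∧
            ((s.2 = true ∧ 3 ∣ p.1 ∧ 3 ∣ s.1) → s.1 + 6 ≤ p.1)) ∧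
          opFree l = k ∧ opSum l = n} := by
  have h := PowerSeries.X_pow_dvd_iff.1 (X_pow_dvd_overGF_sub n.succ) n n.lt_succ_self
  rw [map_sub, sub_eq_zero] at h
  replace h := congrArg (PowerSeries.coeff k) h
  rw [coeff_coeff_overGF, coeff_coeff_overGF, Nat.cast_inj] at h
  refine (ncard_reverse fun l => ?_).trans (h.symm.trans (ncard_reverse fun l => ?_).symm)
  · simp only [nonmultiples, Set.mem_inter_iff, Set.mem_ofPred_eq, opFree_reverse, opSum_reverse,
      List.mem_reverse, ← List.isChain_iff_pairwise, List.isChain_reverse]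
    constructor
    · rintro ⟨⟨h₁, h₂⟩, h₃⟩
      exact ⟨⟨fun p hp => (h₂ p hp).1, h₁⟩, fun p hp => by have := h₂ p hp; omega, h₃⟩
    · rintro ⟨⟨h₁, h₂⟩, h₃, h₄⟩
      exact ⟨⟨h₂, fun p hp => ⟨h₁ p hp, by have := h₃ p hp; omega⟩⟩, h₄⟩
  · simp only [schurLists, Set.mem_inter_iff, Set.mem_ofPred_eq, opFree_reverse, opSum_reverse,
      List.mem_reverse, List.length_reverse, true_and, ← List.isChain_iff_pairwise,
      List.isChain_reverse]
    constructor
    · rintro ⟨⟨-, h₁, h₂⟩, h₃⟩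
      exact ⟨⟨h₂, h₁.imp fun _ _ h => h.1⟩, h₁.imp fun _ _ h => h.2, h₃⟩
    · rintro ⟨⟨h₁, h₂⟩, h₃, h₄⟩
      refine ⟨⟨?_, List.isChain_iff_getElem.2 fun i hi =>
        ⟨List.isChain_iff_getElem.1 h₂ i hi, List.isChain_iff_getElem.1 h₃ i hi⟩, h₁⟩, h₄⟩
      have := length_le_opSum h₁
      omega
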